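/- Let T be a tempered measure on ℝ^d. Then the distributional Fourier transform T̂ is strongly almost periodic as a distribution if and only if T̂ is translation bounded as a distribution and T is a pure-point measure. -/

import Mathlib

set_option linter.unusedSectionVars false

open MeasureTheory Filter Metric Complex SchwartzMap
open scoped Topology ENNReal NNReal ComplexConjugate

noncomputable section

section Preamble

variable {E : Type*} [NormedAddCommGroup E] [InnerProductSpace ℝ E] [FiniteDimensional ℝ E]
  [MeasurableSpace E] [BorelSpace E]

/-- A set is relatively dense if it has bounded gaps. -/
def IsRelativelyDense (A : Set E) : Prop :=
  ∃ r : ℝ, ∀ x : E, ∃ a ∈ A, dist x a ≤ r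

/-- Bohr almost periodic functions: uniformly continuous, bounded, with relatively
dense sets of ε-almost periods. -/
def IsBohrAP (f : E → ℂ) : Prop :=
  UniformContinuous f ∧ (∃ C : ℝ, ∀ x, ‖f x‖ ≤ C) ∧
    ∀ ε : ℝ, 0 < ε → IsRelativelyDense {t : E | ∀ x, ‖f (x - t) - f x‖ < ε}

/-- Bounded functions. -/
def IsBddFun (f : E → ℂ) : Prop := ∃ C : ℝ, ∀ x, ‖f x‖ ≤ C

lemma isometry_const_sub (x : E) : Isometry (fun y : E => x - y) :=
  Isometry.of_dist_eq (fun a b => dist_sub_left x a b)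

lemma hasTemperateGrowth_const_sub (x : E) :
    Function.HasTemperateGrowth (fun y : E => x - y) := by
  apply Function.HasTemperateGrowth.of_fderiv (k := 1) (C := ‖x‖ + 1)
  · have h : (fderiv ℝ (fun y : E => x - y)) =
        fun _ : E => ((0 : E →L[ℝ] E) - ContinuousLinearMap.id ℝ E) := by
      funext y
      exact ((hasFDerivAt_const x y).sub (hasFDerivAt_id y)).fderiv
    rw [h]
    exact Function.HasTemperateGrowth.const _
  · exact (differentiable_const x).sub differentiable_id
  · intro y
    have h1 : ‖x - y‖ ≤ ‖x‖ + ‖y‖ := norm_sub_le x y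
    have h2 : (0:ℝ) ≤ ‖x‖ := norm_nonneg x
    have h3 : (0:ℝ) ≤ ‖y‖ := norm_nonneg y
    calc ‖x - y‖ ≤ ‖x‖ + ‖y‖ := h1
      _ ≤ (‖x‖ + 1) * (1 + ‖y‖) ^ 1 := by nlinarith

/-- The reflected translate `y ↦ ψ (x - y)` of a Schwartz function. -/
def transRefl (x : E) (ψ : SchwartzMap E ℂ) : SchwartzMap E ℂ :=
  SchwartzMap.compCLMOfAntilipschitz (K := 1) ℝ (hasTemperateGrowth_const_sub x)
    (isometry_const_sub x).antilipschitz ψ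

@[simp] lemma transRefl_apply (x : E) (ψ : SchwartzMap E ℂ) (y : E) :
    transRefl x ψ y = ψ (x - y) := rfl

/-- Convolution of a tempered distribution with a Schwartz function:
`(T * ψ)(x) = T (ψ (x - ·))`. -/
def convTD (T : SchwartzMap E ℂ →L[ℂ] ℂ) (ψ : SchwartzMap E ℂ) : E → ℂ :=
  fun x => T (transRefl x ψ)

/-- Smooth compactly supported test function, regarded inside the Schwartz space. -/
def IsTestFn (φ : SchwartzMap E ℂ) : Prop := HasCompactSupport ⇑φ

/-- Translation bounded as a tempered distribution. -/
def TransBddTD (T : SchwartzMap E ℂ →L[ℂ] ℂ) : Prop :=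
  ∀ ψ : SchwartzMap E ℂ, IsBddFun (convTD T ψ)

/-- Translation bounded as a distribution. -/
def TransBddD (T : SchwartzMap E ℂ →L[ℂ] ℂ) : Prop :=
  ∀ ψ : SchwartzMap E ℂ, IsTestFn ψ → IsBddFun (convTD T ψ)

/-- Strongly almost periodic as a tempered distribution. -/
def SAPTD (T : SchwartzMap E ℂ →L[ℂ] ℂ) : Prop :=
  ∀ ψ : SchwartzMap E ℂ, IsBohrAP (convTD T ψ)

/-- Strongly almost periodic as a distribution. -/
def SAPD (T : SchwartzMap E ℂ →L[ℂ] ℂ) : Prop :=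
  ∀ ψ : SchwartzMap E ℂ, IsTestFn ψ → IsBohrAP (convTD T ψ)

/-- The distributional Fourier transform, `T̂(φ) = T(φ̂)`, with the convention
`φ̂(ξ) = ∫ e^{-2πi⟨x,ξ⟩} φ(x) dx`. -/
def fourierTD (T : SchwartzMap E ℂ →L[ℂ] ℂ) : SchwartzMap E ℂ →L[ℂ] ℂ :=
  T.comp (SchwartzMap.fourierTransformCLM ℂ)

/-- A complex Radon measure, encoded by its total variation measure together with a
unimodular density (polar decomposition). -/
structure CMeasure (E : Type*) [TopologicalSpace E] [MeasurableSpace E] where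
  /-- the total variation measure -/
  tv : Measure E
  locFin : IsLocallyFiniteMeasure tv
  /-- the unimodular density -/
  density : E → ℂ
  density_meas : Measurable density
  density_norm : ∀ᵐ x ∂tv, ‖density x‖ = 1

namespace CMeasure

/-- Pairing of a complex measure with a function: `μ(φ) = ∫ φ dμ`. -/
def pairing (μ : CMeasure E) (φ : E → ℂ) : ℂ := ∫ x, φ x * μ.density x ∂μ.tv

/-- The complex measure agrees with the tempered distribution `T` on all smooth
compactly supported test functions; i.e. `μ` is a tempered measure identified with `T`. -/
def Agrees (μ : CMeasure E) (T : SchwartzMap E ℂ →L[ℂ] ℂ) : Prop :=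
  ∀ φ : SchwartzMap E ℂ, IsTestFn φ → T φ = μ.pairing ⇑φ

/-- A tempered measure is one that extends to a tempered distribution. -/
def IsTempered (μ : CMeasure E) : Prop := ∃ T, μ.Agrees T

/-- Pure point measure: concentrated on a countable set. -/
def IsPurePoint (μ : CMeasure E) : Prop := ∃ S : Set E, S.Countable ∧ μ.tv Sᶜ = 0

/-- Convolution of a complex measure with a function: `(μ * φ)(x) = ∫ φ(x - y) dμ(y)`. -/
def convM (μ : CMeasure E) (φ : E → ℂ) : E → ℂ :=
  fun x => ∫ y, φ (x - y) * μ.density y ∂μ.tv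

/-- Translation bounded as a measure. -/
def TransBddM (μ : CMeasure E) : Prop :=
  ∀ φ : E → ℂ, Continuous φ → HasCompactSupport φ → IsBddFun (μ.convM φ)

/-- Strongly almost periodic as a measure. -/
def SAPM (μ : CMeasure E) : Prop :=
  ∀ φ : E → ℂ, Continuous φ → HasCompactSupport φ → IsBohrAP (μ.convM φ)

/-- Strongly tempered measure: the total variation has polynomial growth,
equivalently `|μ|` is a tempered (slowly increasing) measure. -/
def IsStronglyTempered (μ : CMeasure E) : Prop :=
  ∃ C a : ℝ, ∀ r : ℝ, 1 ≤ r → μ.tv (Metric.closedBall 0 r) ≤ ENNReal.ofReal (C * r ^ a)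

/-- The atom of a complex measure at a point: `μ({x})`. -/
def atom (μ : CMeasure E) (x : E) : ℂ := (μ.tv {x}).toReal • μ.density x

/-- The measure is concentrated on a locally finite set. -/
def LocallyFiniteSupport (μ : CMeasure E) : Prop :=
  ∃ S : Set E, (∀ K : Set E, IsCompact K → (S ∩ K).Finite) ∧ μ.tv Sᶜ = 0

end CMeasure

end Preamble

section PartA

variable {E : Type*} [NormedAddCommGroup E] [InnerProductSpace ℝ E] [FiniteDimensional ℝ E]
  [MeasurableSpace E] [BorelSpace E]

/-- Bounded continuous functions with values in a normed group. -/
abbrev NBCF (X F : Type*) [TopologicalSpace X] [NormedAddCommGroup F] : Type _ :=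
  BoundedContinuousFunction X F

/-- Weighted derivative as a bounded continuous function. -/
def PhiSW (k n : ℕ) : SchwartzMap E ℂ →ₗ[ℂ] NBCF E (E [×n]→L[ℝ] ℂ) where
  toFun φ := BoundedContinuousFunction.ofNormedAddCommGroup
    (fun x => (‖x‖ ^ k) • iteratedFDeriv ℝ n φ x)
    ((continuous_norm.pow k).smul ((φ.smooth n).continuous_iteratedFDeriv le_rfl))
    (SchwartzMap.seminorm ℂ k n φ) (fun x => by
      rw [norm_smul, Real.norm_of_nonneg (by positivity)]
      exact φ.le_seminorm ℂ k n x)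
  map_add' φ ψ := by
    ext1 x
    have : (⇑(φ + ψ) : E → ℂ) = ⇑φ + ⇑ψ := rfl
    simp only [BoundedContinuousFunction.coe_ofNormedAddCommGroup,
      BoundedContinuousFunction.coe_add, Pi.add_apply]
    rw [this, iteratedFDeriv_add ((φ.smooth n).of_le le_rfl) ((ψ.smooth n).of_le le_rfl)]
    simp [smul_add]
  map_smul' c φ := by
    ext1 x
    have : (⇑(c • φ) : E → ℂ) = c • ⇑φ := rfl
    simp only [BoundedContinuousFunction.coe_ofNormedAddCommGroup,
      BoundedContinuousFunction.coe_smul, RingHom.id_apply]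
    rw [this, iteratedFDeriv_const_smul_apply (φ.smooth n).contDiffAt, smul_comm]

lemma PhiSW_apply (k n : ℕ) (φ : SchwartzMap E ℂ) (x : E) :
    PhiSW k n φ x = (‖x‖ ^ k) • iteratedFDeriv ℝ n φ x := rfl

lemma seminorm_le_PhiSW (k n : ℕ) (φ : SchwartzMap E ℂ) :
    SchwartzMap.seminorm ℂ k n φ ≤ ‖PhiSW k n φ‖ := by
  refine SchwartzMap.seminorm_le_bound ℂ k n φ (norm_nonneg _) (fun x => ?_)
  have := (PhiSW k n φ).norm_coe_le_norm x
  rwa [PhiSW_apply, norm_smul, Real.norm_of_nonneg (by positivity)] at this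

lemma exists_extension_of_bound {V W : Type*} [AddCommGroup V] [Module ℂ V]
    [NormedAddCommGroup W] [NormedSpace ℂ W] (Φ : V →ₗ[ℂ] W) (T : V →ₗ[ℂ] ℂ) (C : ℝ)
    (h : ∀ v, ‖T v‖ ≤ C * ‖Φ v‖) : ∃ S : W →L[ℂ] ℂ, ∀ v, T v = S (Φ v) := by
  have hk : LinearMap.ker Φ ≤ LinearMap.ker T := by
    intro v hv
    have := h v
    rw [LinearMap.mem_ker.1 hv] at this
    simpa using this
  let L : LinearMap.range Φ →ₗ[ℂ] ℂ :=
    ((LinearMap.ker Φ).liftQ T hk) ∘ₗ (Φ.quotKerEquivRange.symm : _ →ₗ[ℂ] _)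
  have hL : ∀ v, L ⟨Φ v, LinearMap.mem_range_self Φ v⟩ = T v := by
    intro v
    have : Φ.quotKerEquivRange.symm ⟨Φ v, LinearMap.mem_range_self Φ v⟩
        = (LinearMap.ker Φ).mkQ v := Φ.quotKerEquivRange_symm_apply_image v _
    simp only [L, LinearMap.comp_apply, LinearEquiv.coe_coe, this]
    simp
  let L' : StrongDual ℂ (LinearMap.range Φ) := L.mkContinuous C (by
    rintro ⟨w, v, rfl⟩
    rw [hL]
    exact h v)
  obtain ⟨g, hg, -⟩ := exists_extension_norm_eq (LinearMap.range Φ) L'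
  refine ⟨g, fun v => ?_⟩
  have := hg ⟨Φ v, LinearMap.mem_range_self Φ v⟩
  rw [this]
  exact (hL v).symm

lemma isBoundedLinearMap_integral {V W : Type*} [NormedAddCommGroup V] [NormedSpace ℝ V]
    [CompleteSpace V] [NormedAddCommGroup W] [NormedSpace ℝ W] [CompleteSpace W]
    {Y : Type*} [MeasurableSpace Y] {m : Measure Y} {L : V → W} (hL : IsBoundedLinearMap ℝ L)
    {f : Y → V} (hf : Integrable f m) : L (∫ y, f y ∂m) = ∫ y, L (f y) ∂m :=
  (hL.toContinuousLinearMap.integral_comp_comm hf).symm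

lemma iteratedFDeriv_integral {Y : Type*} [MeasurableSpace Y] (m : Measure Y)
    (G : Y → SchwartzMap E ℂ) (φ : SchwartzMap E ℂ)
    (hG : ∀ k n, Integrable (fun y => PhiSW k n (G y)) m)
    (hφ : ∀ x, φ x = ∫ y, G y x ∂m) (n : ℕ) :
    ∀ x, iteratedFDeriv ℝ n φ x = ∫ y, iteratedFDeriv ℝ n (G y) x ∂m := by
  have hint : ∀ n x, Integrable (fun y => iteratedFDeriv ℝ n (G y) x) m := by
    intro n x
    have := (BoundedContinuousFunction.evalCLM ℂ x).integrable_comp (hG 0 n)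
    simpa [PhiSW_apply] using this
  induction n with
  | zero =>
    intro x
    simp only [iteratedFDeriv_zero_eq_comp, Function.comp_apply]
    rw [hφ x]
    exact ((continuousMultilinearCurryFin0 ℝ E ℂ).symm.toContinuousLinearEquiv.integral_comp_comm
      _).symm
  | succ n ih =>
    intro x
    have h1 : HasFDerivAt (fun x => ∫ y, iteratedFDeriv ℝ n (G y) x ∂m)
        (∫ y, continuousMultilinearCurryLeftEquiv ℝ (fun _ => E) ℂ
          (iteratedFDeriv ℝ (n + 1) (G y) x) ∂m) x := by
      refine hasFDerivAt_integral_of_dominated_of_fderiv_le (s := Set.univ)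
        (F' := fun x y => continuousMultilinearCurryLeftEquiv ℝ (fun _ => E) ℂ
          (iteratedFDeriv ℝ (n + 1) (G y) x))
        (bound := fun y => ‖PhiSW 0 (n + 1) (G y)‖) univ_mem
        (Eventually.of_forall fun x => (hint n x).1) (hint n x) ?_ ?_ (hG 0 (n + 1)).norm ?_
      · exact ((continuousMultilinearCurryLeftEquiv ℝ
          (fun _ => E) ℂ).continuous.comp_aestronglyMeasurable (hint (n + 1) x).1)
      · refine Eventually.of_forall fun y z _ => ?_
        rw [LinearIsometryEquiv.norm_map]
        simpa [PhiSW_apply] using (PhiSW 0 (n + 1) (G y)).norm_coe_le_norm z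
      · refine Eventually.of_forall fun y z _ => ?_
        have hd : DifferentiableAt ℝ (iteratedFDeriv ℝ n (G y)) z :=
          (((G y).smooth (n + 1)).differentiable_iteratedFDeriv
            (by exact_mod_cast Nat.lt_succ_self n)) z
        have := hd.hasFDerivAt
        rw [fderiv_iteratedFDeriv] at this
        exact this
    have h2 : iteratedFDeriv ℝ n φ = fun x => ∫ y, iteratedFDeriv ℝ n (G y) x ∂m := funext ih
    rw [iteratedFDeriv_succ_eq_comp_left, Function.comp_apply, h2, h1.fderiv]
    rw [LinearIsometryEquiv.symm_apply_eq]
    have hb : IsBoundedLinearMap ℝ (fun a : E [×(n + 1)]→L[ℝ] ℂ =>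
        (continuousMultilinearCurryLeftEquiv ℝ (fun _ : Fin (n + 1) => E) ℂ a :
          E →L[ℝ] (E [×n]→L[ℝ] ℂ))) := by
      refine ⟨⟨fun a b => ?_, fun c a => ?_⟩, 1, one_pos, fun a => ?_⟩
      · exact map_add _ a b
      · exact map_smul _ c a
      · rw [LinearIsometryEquiv.norm_map, one_mul]
    exact (isBoundedLinearMap_integral hb (hint (n + 1) x)).symm

/-- Interchange of a tempered distribution with an integral. -/
lemma interchange (U : SchwartzMap E ℂ →L[ℂ] ℂ) {Y : Type*} [MeasurableSpace Y] (m : Measure Y)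
    (G : Y → SchwartzMap E ℂ) (φ : SchwartzMap E ℂ)
    (hG : ∀ k n, Integrable (fun y => PhiSW k n (G y)) m)
    (hφ : ∀ x, φ x = ∫ y, G y x ∂m) : U φ = ∫ y, U (G y) ∂m := by
  obtain ⟨s, C, hC, hs⟩ := Seminorm.bound_of_continuous (schwartz_withSeminorms ℂ E ℂ)
    (U.toLinearMap.toSeminorm) (by
      have : Continuous fun φ => ‖U φ‖ := U.continuous.norm
      exact this)
  let Φ : SchwartzMap E ℂ →ₗ[ℂ]
      (∀ i : s, NBCF E (E [×i.1.2]→L[ℝ] ℂ)) :=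
    LinearMap.pi (fun i => PhiSW i.1.1 i.1.2)
  have hbd : ∀ φ, ‖U.toLinearMap φ‖ ≤ C * ‖Φ φ‖ := by
    intro φ
    have h1 : ‖U φ‖ ≤ C * (s.sup (schwartzSeminormFamily ℂ E ℂ)) φ := hs φ
    refine h1.trans (mul_le_mul_of_nonneg_left ?_ C.2)
    refine Seminorm.finset_sup_apply_le (norm_nonneg _) (fun i hi => ?_)
    refine (seminorm_le_PhiSW i.1 i.2 φ).trans ?_
    exact norm_le_pi_norm (Φ φ) ⟨i, hi⟩
  obtain ⟨S, hS⟩ := exists_extension_of_bound Φ U.toLinearMap C hbd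
  have hS' : ∀ φ, U φ = S (Φ φ) := hS
  have hint : Integrable (fun y => Φ (G y)) m := by
    apply Integrable.of_eval
    intro i
    exact hG i.1.1 i.1.2
  have key : Φ φ = ∫ y, Φ (G y) ∂m := by
    funext i
    rw [eval_integral (f := fun y => Φ (G y)) (fun i : s => hG i.1.1 i.1.2)]
    ext1 x
    have h3 := (BoundedContinuousFunction.evalCLM ℂ x).integral_comp_comm (hG i.1.1 i.1.2)
    simp only [BoundedContinuousFunction.evalCLM_apply] at h3
    rw [show (fun a => (Φ (G a)) i) = fun y => PhiSW i.1.1 i.1.2 (G y) from rfl, ← h3]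
    show PhiSW i.1.1 i.1.2 φ x = _
    simp only [PhiSW_apply]
    rw [iteratedFDeriv_integral m G φ hG hφ, integral_smul]
  simp_rw [hS']
  rw [key, S.integral_comp_comm hint]

end PartA

section PartB

variable {E : Type*} [NormedAddCommGroup E] [InnerProductSpace ℝ E] [FiniteDimensional ℝ E]
  [MeasurableSpace E] [BorelSpace E]

lemma wbound (η : SchwartzMap E ℂ) (k n : ℕ) (M : ℝ) (z w : E) (h : ‖z - w‖ ≤ M) :
    ‖z‖ ^ k * ‖iteratedFDeriv ℝ n η w‖ ≤
      2 ^ k * (SchwartzMap.seminorm ℂ k n η + M ^ k * SchwartzMap.seminorm ℂ 0 n η) := by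
  have hM : 0 ≤ M := (norm_nonneg _).trans h
  have h1 : ‖z‖ ≤ ‖w‖ + M := by
    have := norm_add_le w (z - w)
    simp only [add_sub_cancel] at this
    linarith
  have h2 : ‖z‖ ^ k ≤ 2 ^ k * (‖w‖ ^ k + M ^ k) := by
    calc ‖z‖ ^ k ≤ (‖w‖ + M) ^ k := pow_le_pow_left₀ (norm_nonneg _) h1 k
      _ ≤ 2 ^ (k - 1) * (‖w‖ ^ k + M ^ k) := add_pow_le (norm_nonneg _) hM k
      _ ≤ 2 ^ k * (‖w‖ ^ k + M ^ k) := by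
        gcongr
        · norm_num
        · omega
  have h3 := η.le_seminorm ℂ k n w
  have h4 := η.le_seminorm ℂ 0 n w
  simp only [pow_zero, one_mul] at h4
  calc ‖z‖ ^ k * ‖iteratedFDeriv ℝ n η w‖
      ≤ (2 ^ k * (‖w‖ ^ k + M ^ k)) * ‖iteratedFDeriv ℝ n η w‖ := by gcongr
    _ = 2 ^ k * (‖w‖ ^ k * ‖iteratedFDeriv ℝ n η w‖ + M ^ k * ‖iteratedFDeriv ℝ n η w‖) := by ring
    _ ≤ _ := by gcongr

lemma PhiSW_transRefl (k n : ℕ) (ψ : SchwartzMap E ℂ) (x z : E) :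
    PhiSW k n (transRefl x ψ) z = (‖z‖ ^ k) • iteratedFDeriv ℝ n (transRefl 0 ψ) (z - x) := by
  rw [PhiSW_apply]
  congr 1
  rw [← iteratedFDeriv_comp_sub]
  congr 1
  funext w
  simp

lemma PhiSW_transRefl_norm (k n : ℕ) (ψ : SchwartzMap E ℂ) (x : E) :
    ‖PhiSW k n (transRefl x ψ)‖ ≤ 2 ^ k * (SchwartzMap.seminorm ℂ k n (transRefl 0 ψ) +
      ‖x‖ ^ k * SchwartzMap.seminorm ℂ 0 n (transRefl 0 ψ)) := by
  refine (BoundedContinuousFunction.norm_le (by positivity)).2 (fun z => ?_)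
  rw [PhiSW_transRefl, norm_smul, Real.norm_of_nonneg (by positivity)]
  exact wbound _ _ _ _ _ _ (by simp)

lemma PhiSW_transRefl_lip (k n : ℕ) (ψ : SchwartzMap E ℂ) (M : ℝ) (x x' : E)
    (hx : ‖x‖ ≤ M) (hx' : ‖x'‖ ≤ M) :
    ‖PhiSW k n (transRefl x ψ) - PhiSW k n (transRefl x' ψ)‖ ≤
      2 ^ k * (SchwartzMap.seminorm ℂ k (n + 1) (transRefl 0 ψ) +
        M ^ k * SchwartzMap.seminorm ℂ 0 (n + 1) (transRefl 0 ψ)) * ‖x - x'‖ := by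
  have hM : 0 ≤ M := (norm_nonneg _).trans hx
  refine (BoundedContinuousFunction.norm_le (by positivity)).2 (fun z => ?_)
  rw [BoundedContinuousFunction.coe_sub, Pi.sub_apply, PhiSW_transRefl, PhiSW_transRefl]
  set η := transRefl 0 ψ
  have hd : ∀ w, DifferentiableAt ℝ (iteratedFDeriv ℝ n η) w := fun w =>
          ((η.smooth (n + 1)).differentiable_iteratedFDeriv
            (by exact_mod_cast Nat.lt_succ_self n)) w
  have := (convex_closedBall z M).norm_image_sub_le_of_norm_fderiv_le (𝕜 := ℝ)
    (f := fun w => (‖z‖ ^ k) • iteratedFDeriv ℝ n η w) (x := z - x') (y := z - x)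
    (C := 2 ^ k * (SchwartzMap.seminorm ℂ k (n + 1) η +
        M ^ k * SchwartzMap.seminorm ℂ 0 (n + 1) η))
    (fun w _ => (hd w).fun_const_smul _) (fun w hw => ?_) (by simpa using hx') (by simpa using hx)
  · refine this.trans (le_of_eq ?_)
    congr 1
    rw [show z - x - (z - x') = -(x - x') by abel, norm_neg]
  · rw [fderiv_fun_const_smul (hd w), norm_smul, Real.norm_of_nonneg (by positivity),
      norm_fderiv_iteratedFDeriv]
    refine wbound _ _ _ _ _ _ ?_
    rw [mem_closedBall, dist_comm, dist_eq_norm] at hw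
    exact hw

lemma PhiSW_transRefl_continuous (k n : ℕ) (ψ : SchwartzMap E ℂ) :
    Continuous (fun x : E => PhiSW k n (transRefl x ψ)) := by
  rw [continuous_iff_continuousAt]
  intro x
  rw [ContinuousAt, tendsto_iff_norm_sub_tendsto_zero]
  set B := 2 ^ k * (SchwartzMap.seminorm ℂ k (n + 1) (transRefl 0 ψ) +
        (‖x‖ + 1) ^ k * SchwartzMap.seminorm ℂ 0 (n + 1) (transRefl 0 ψ))
  have h0 : Tendsto (fun e : E => B * ‖e - x‖) (𝓝 x) (𝓝 0) := by
    have : Continuous (fun e : E => B * ‖e - x‖) := by fun_prop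
    simpa using this.tendsto x
  refine squeeze_zero' (Eventually.of_forall fun _ => norm_nonneg _) ?_ h0
  filter_upwards [closedBall_mem_nhds x one_pos] with e he
  refine PhiSW_transRefl_lip k n ψ _ e x ?_ (by linarith)
  rw [mem_closedBall, dist_eq_norm] at he
  have := norm_add_le x (e - x)
  simp only [add_sub_cancel] at this
  linarith

lemma transRefl_integral (U : SchwartzMap E ℂ →L[ℂ] ℂ) {Y : Type*} [TopologicalSpace Y]
    [MeasurableSpace Y] [OpensMeasurableSpace Y] [SecondCountableTopology Y]
    (m : Measure Y) (c : Y → ℂ) (a : Y → E) (hc : Continuous c) (ha : Continuous a)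
    (hint : ∀ k : ℕ, Integrable (fun y => ‖c y‖ * ‖a y‖ ^ k) m) (ψ φ : SchwartzMap E ℂ)
    (hφ : ∀ z, φ z = ∫ y, c y * ψ (a y - z) ∂m) :
    U φ = ∫ y, c y * U (transRefl (a y) ψ) ∂m := by
  rw [interchange U m (fun y => c y • transRefl (a y) ψ) φ ?_ ?_]
  · simp
  · intro k n
    simp only [map_smul]
    have hcont : Continuous (fun y => c y • PhiSW k n (transRefl (a y) ψ)) :=
      hc.smul ((PhiSW_transRefl_continuous k n ψ).comp ha)
    refine Integrable.mono' (g := fun y => 2 ^ k * (SchwartzMap.seminorm ℂ k n (transRefl 0 ψ))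
      * (‖c y‖ * ‖a y‖ ^ 0) + 2 ^ k * SchwartzMap.seminorm ℂ 0 n (transRefl 0 ψ) *
      (‖c y‖ * ‖a y‖ ^ k)) (((hint 0).const_mul _).add ((hint k).const_mul _))
      hcont.aestronglyMeasurable (Eventually.of_forall fun y => ?_)
    rw [norm_smul]
    calc _ ≤ ‖c y‖ * _ := mul_le_mul_of_nonneg_left (PhiSW_transRefl_norm k n ψ (a y))
            (norm_nonneg _)
      _ = _ := by ring
  · intro z
    rw [hφ]
    rfl

lemma convTD_continuous (U : SchwartzMap E ℂ →L[ℂ] ℂ) (ψ : SchwartzMap E ℂ) :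
    Continuous (convTD U ψ) := by
  have h : Continuous (fun x : E => transRefl x ψ) := by
    rw [continuous_iff_continuousAt]
    intro x
    rw [ContinuousAt, (schwartz_withSeminorms ℂ E ℂ).tendsto_nhds]
    rintro ⟨k, n⟩ ε hε
    have h1 := (PhiSW_transRefl_continuous k n ψ).continuousAt (x := x)
    rw [ContinuousAt, tendsto_iff_norm_sub_tendsto_zero] at h1
    filter_upwards [h1.eventually (gt_mem_nhds hε)] with y hy
    refine lt_of_le_of_lt (seminorm_le_PhiSW k n _) ?_
    rwa [map_sub]
  exact U.continuous.comp h

/-- Convolving with an integrable Schwartz kernel. -/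
lemma convTD_conv (U : SchwartzMap E ℂ →L[ℂ] ℂ) (ψ κ K : SchwartzMap E ℂ)
    (hK : ∀ x, K x = ∫ y, κ y * ψ (x - y)) (x : E) :
    convTD U K x = ∫ y, κ y * convTD U ψ (x - y) := by
  refine transRefl_integral U volume κ (fun y => x - y) κ.continuous (by fun_prop) (fun k => ?_)
    ψ (transRefl x K) (fun z => ?_)
  · refine Integrable.mono' (g := fun y => 2 ^ k * ‖x‖ ^ k * ‖κ y‖ + 2 ^ k * (‖y‖ ^ k * ‖κ y‖))
      ((κ.integrable.norm.const_mul _).add ((κ.integrable_pow_mul volume k).const_mul _))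
      (Continuous.aestronglyMeasurable (by fun_prop)) (Eventually.of_forall fun y => ?_)
    rw [Real.norm_of_nonneg (by positivity)]
    have h2 : ‖x - y‖ ^ k ≤ 2 ^ k * (‖x‖ ^ k + ‖y‖ ^ k) := by
      calc ‖x - y‖ ^ k ≤ (‖x‖ + ‖y‖) ^ k := pow_le_pow_left₀ (norm_nonneg _) (norm_sub_le _ _) k
        _ ≤ 2 ^ (k - 1) * (‖x‖ ^ k + ‖y‖ ^ k) := add_pow_le (norm_nonneg _) (norm_nonneg _) k
        _ ≤ 2 ^ k * (‖x‖ ^ k + ‖y‖ ^ k) := by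
          gcongr
          · norm_num
          · omega
    calc ‖κ y‖ * ‖x - y‖ ^ k ≤ ‖κ y‖ * (2 ^ k * (‖x‖ ^ k + ‖y‖ ^ k)) := by gcongr
      _ = _ := by ring
  · rw [transRefl_apply, hK]
    simp only [sub_right_comm]

lemma convTD_lipschitz (U : SchwartzMap E ℂ →L[ℂ] ℂ) (hU : TransBddD U) (ψ : SchwartzMap E ℂ)
    (hψ : IsTestFn ψ) : ∃ C : ℝ, 0 ≤ C ∧ ∀ x v, ‖convTD U ψ (x + v) - convTD U ψ x‖ ≤ C * ‖v‖ := by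
  let b := stdOrthonormalBasis ℝ E
  let D : E → SchwartzMap E ℂ := fun v => LineDeriv.lineDerivOp v ψ
  have hD : ∀ v, IsTestFn (D v) := fun v =>
    hψ.of_isClosed_subset (isClosed_tsupport _) (SchwartzMap.tsupport_lineDerivOp_subset v ψ)
  choose C hC using fun v => hU (D v) (hD v)
  have hC0 : ∀ v, 0 ≤ C v := fun v => (norm_nonneg _).trans (hC v 0)
  refine ⟨∑ i, C (b i), Finset.sum_nonneg fun i _ => hC0 _, fun x v => ?_⟩
  have hDv : ∀ y, ‖U (transRefl y (D v))‖ ≤ (∑ i, C (b i)) * ‖v‖ := by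
    intro y
    have h1 : transRefl y (D v) = ∑ i, ((b.repr v i : ℝ) : ℂ) • transRefl y (D (b i)) := by
      ext z
      have hs : (∑ i, ((b.repr v i : ℝ) : ℂ) • transRefl y (D (b i))) z =
        ∑ i, ((b.repr v i : ℝ) : ℂ) * D (b i) (y - z) := by
        rw [SchwartzMap.sum_apply]
        rfl
      rw [hs, transRefl_apply]
      simp only [D, SchwartzMap.lineDerivOp_apply_eq_fderiv]
      conv_lhs => rw [← b.sum_repr v]
      rw [map_sum]
      simp
    rw [h1, map_sum, Finset.sum_mul]
    refine (norm_sum_le _ _).trans (Finset.sum_le_sum fun i _ => ?_)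
    rw [map_smul, norm_smul, mul_comm]
    refine mul_le_mul (hC (b i) y) ?_ (norm_nonneg _) (hC0 _)
    rw [Complex.norm_real]
    have := (EuclideanSpace.norm_eq (b.repr v))
    calc ‖b.repr v i‖ ≤ ‖b.repr v‖ := PiLp.norm_apply_le _ i
      _ = ‖v‖ := b.repr.norm_map v
  have key := transRefl_integral U (volume.restrict (Set.Icc (0:ℝ) 1)) (fun _ => 1)
    (fun s => x + s • v) continuous_const (by fun_prop) (fun k => ?_) (D v)
    (transRefl (x + v) ψ - transRefl x ψ) (fun z => ?_)
  · have : convTD U ψ (x + v) - convTD U ψ x = U (transRefl (x + v) ψ - transRefl x ψ) := by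
      rw [map_sub]; rfl
    rw [this, key]
    have := norm_setIntegral_le_of_norm_le_const (μ := volume) (s := Set.Icc (0:ℝ) 1)
      (f := fun s : ℝ => (1:ℂ) * U (transRefl (x + s • v) (D v))) (C := (∑ i, C (b i)) * ‖v‖)
      (by simp) (fun s _ => by simpa using hDv (x + s • v))
    simpa using this
  · have : Continuous (fun s : ℝ => ‖(1:ℂ)‖ * ‖x + s • v‖ ^ k) := by fun_prop
    exact this.integrableOn_Icc
  · have hderiv : ∀ s : ℝ, HasDerivAt (fun s : ℝ => ψ (x + s • v - z)) (D v (x + s • v - z)) s := by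
      intro s
      have h1 : HasDerivAt (fun s : ℝ => x + s • v - z) v s := by
        have := (((hasDerivAt_id s).smul_const v).const_add x).sub_const z
        simpa using this
      have h2 := (ψ.hasFDerivAt (x + s • v - z)).comp_hasDerivAt s h1
      have h4 : D v (x + s • v - z) = fderiv ℝ ψ (x + s • v - z) v :=
        SchwartzMap.lineDerivOp_apply_eq_fderiv _ _ _
      rw [h4]
      exact h2
    have h3 := intervalIntegral.integral_eq_sub_of_hasDerivAt (a := 0) (b := 1)
      (fun s _ => hderiv s) (Continuous.intervalIntegrable (by fun_prop) _ _)
    rw [intervalIntegral.integral_of_le zero_le_one, ← integral_Icc_eq_integral_Ioc] at h3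
    simp only [one_mul]
    rw [h3]
    simp

end PartB

section PartC

open scoped FourierTransform RealInnerProductSpace

variable {E : Type*} [NormedAddCommGroup E] [InnerProductSpace ℝ E] [FiniteDimensional ℝ E]
  [MeasurableSpace E] [BorelSpace E]

/-- Finite-colouring version of total boundedness of the set of translates. -/
def BAP (f : E → ℂ) : Prop :=
  ∀ ε : ℝ, 0 < ε → ∃ (n : ℕ) (c : E → Fin n),
    ∀ t t', c t = c t' → ∀ x, ‖f (x - t) - f (x - t')‖ < ε

lemma exists_colouring {X Y : Type*} [PseudoMetricSpace X] {K : Set X} (hK : TotallyBounded K)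
    (z : Y → X) (hz : ∀ y, z y ∈ K) (ε : ℝ) (hε : 0 < ε) :
    ∃ (n : ℕ) (c : Y → Fin n), ∀ y y', c y = c y' → dist (z y) (z y') < ε := by
  obtain ⟨t, ht, hKt⟩ := Metric.totallyBounded_iff.1 hK (ε / 2) (half_pos hε)
  have h : ∀ y, ∃ a : t, dist (z y) a < ε / 2 := by
    intro y
    have := hKt (hz y)
    simp only [Set.mem_iUnion, mem_ball] at this
    obtain ⟨a, ha, h⟩ := this
    exact ⟨⟨a, ha⟩, h⟩
  choose c hc using h
  have : Finite t := ht
  obtain ⟨n, ⟨e⟩⟩ := Finite.exists_equiv_fin t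
  refine ⟨n, fun y => e (c y), fun y y' h => ?_⟩
  have h' : c y = c y' := e.injective h
  have h1 := hc y
  have h2 := hc y'
  rw [← h'] at h2
  have := dist_triangle_right (z y) (z y') (c y : X)
  linarith

lemma BAP.of_isBohrAP {f : E → ℂ} (hf : IsBohrAP f) : BAP f := by
  intro ε hε
  obtain ⟨huc, -, hap⟩ := hf
  obtain ⟨δ, hδ, hδ'⟩ := Metric.uniformContinuous_iff.1 huc (ε / 3) (by positivity)
  obtain ⟨r, hr⟩ := hap (ε / 3) (by positivity)
  choose a ha hda using hr
  obtain ⟨n, c, hc⟩ := exists_colouring (isCompact_closedBall (0 : E) r).totallyBounded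
    (fun t => t - a t) (fun t => by simpa [dist_eq_norm] using hda t) δ hδ
  refine ⟨n, c, fun t t' h x => ?_⟩
  have h1 := ha t (x - (t - a t))
  have h2 := ha t' (x - (t' - a t'))
  have h3 := @hδ' (x - (t - a t)) (x - (t' - a t')) (by
    rw [dist_sub_left]; exact hc t t' h)
  rw [dist_eq_norm] at h3
  rw [show x - (t - a t) - a t = x - t by abel] at h1
  rw [show x - (t' - a t') - a t' = x - t' by abel] at h2
  rw [norm_sub_rev] at h2
  calc ‖f (x - t) - f (x - t')‖ = ‖(f (x - t) - f (x - (t - a t))) +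
        (f (x - (t - a t)) - f (x - (t' - a t'))) + (f (x - (t' - a t')) - f (x - t'))‖ := by
        congr 1; ring
    _ ≤ _ := norm_add₃_le
    _ < ε := by linarith

lemma BAP.isBohrAP {f : E → ℂ} (hf : BAP f) (huc : UniformContinuous f)
    (hb : ∃ C : ℝ, ∀ x, ‖f x‖ ≤ C) : IsBohrAP f := by
  refine ⟨huc, hb, fun ε hε => ?_⟩
  obtain ⟨n, c, hc⟩ := hf ε hε
  classical
  have hrep : ∃ s : Fin n → E, ∀ t, c (s (c t)) = c t := by
    refine ⟨fun i => if h : ∃ t, c t = i then h.choose else 0, fun t => ?_⟩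
    have h : ∃ t', c t' = c t := ⟨t, rfl⟩
    simp only [dif_pos h]
    exact h.choose_spec
  obtain ⟨s, hs⟩ := hrep
  refine ⟨∑ i, ‖s i‖, fun t => ⟨t - s (c t), fun x => ?_, ?_⟩⟩
  · have := hc t (s (c t)) (hs t).symm (x + s (c t))
    rw [add_sub_cancel_right] at this
    rw [show x - (t - s (c t)) = x + s (c t) - t by abel]
    exact this
  · rw [dist_eq_norm, sub_sub_cancel]
    exact Finset.single_le_sum (f := fun i => ‖s i‖) (fun i _ => norm_nonneg _) (Finset.mem_univ _)

lemma BAP.add {f g : E → ℂ} (hf : BAP f) (hg : BAP g) : BAP (fun x => f x + g x) := by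
  intro ε hε
  obtain ⟨n, c, hc⟩ := hf (ε / 2) (half_pos hε)
  obtain ⟨m, b, hb⟩ := hg (ε / 2) (half_pos hε)
  refine ⟨n * m, fun t => finProdFinEquiv (c t, b t), fun t t' h x => ?_⟩
  have h' := finProdFinEquiv.injective h
  rw [Prod.mk.injEq] at h'
  have h1 := hc t t' h'.1 x
  have h2 := hb t t' h'.2 x
  rw [add_sub_add_comm]
  exact (norm_add_le _ _).trans_lt (by linarith)

lemma BAP.neg {f : E → ℂ} (hf : BAP f) : BAP (fun x => - f x) := by
  intro ε hε
  obtain ⟨n, c, hc⟩ := hf ε hε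
  refine ⟨n, c, fun t t' h x => ?_⟩
  rw [← neg_sub', norm_neg]
  exact hc t t' h x

lemma BAP.zero : BAP (fun _ : E => 0) := fun ε hε => ⟨1, fun _ => 0, by simpa using hε⟩

lemma BAP.sum {ι : Type*} (s : Finset ι) {f : ι → E → ℂ} (hf : ∀ i ∈ s, BAP (f i)) :
    BAP (fun x => ∑ i ∈ s, f i x) := by
  classical
  induction s using Finset.induction_on with
  | empty => simpa using BAP.zero
  | insert a s ha ih =>
    simp only [Finset.sum_insert ha]
    exact (hf a (by simp)).add (ih fun i hi => hf i (by simp [hi]))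

lemma BAP.of_approx {f : E → ℂ} (h : ∀ ε : ℝ, 0 < ε → ∃ g, BAP g ∧ ∀ x, ‖f x - g x‖ < ε) :
    BAP f := by
  intro ε hε
  obtain ⟨g, hg, hfg⟩ := h (ε / 3) (by positivity)
  obtain ⟨n, c, hc⟩ := hg (ε / 3) (by positivity)
  refine ⟨n, c, fun t t' h x => ?_⟩
  have h1 := hfg (x - t)
  have h2 := hfg (x - t')
  rw [norm_sub_rev] at h2
  have h3 := hc t t' h x
  calc ‖f (x - t) - f (x - t')‖ = ‖(f (x - t) - g (x - t)) +
        (g (x - t) - g (x - t')) + (g (x - t') - f (x - t'))‖ := by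
        congr 1; ring
    _ ≤ _ := norm_add₃_le
    _ < ε := by linarith

/-- The character `ξ ↦ exp (-2πi⟨x,ξ⟩)`. -/
def ee (x ξ : E) : ℂ := (Real.fourierChar (-(inner ℝ x ξ)) : ℂ)

lemma ee_norm (x ξ : E) : ‖ee x ξ‖ = 1 := Circle.norm_coe _

lemma ee_add (x y ξ : E) : ee (x + y) ξ = ee x ξ * ee y ξ := by
  simp [ee, inner_add_left, AddChar.map_add_eq_mul, mul_comm]

lemma ee_zero (ξ : E) : ee 0 ξ = 1 := by simp [ee]

lemma ee_comm (x ξ : E) : ee x ξ = ee ξ x := by simp [ee, real_inner_comm]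

lemma ee_continuous : Continuous (fun p : E × E => ee p.1 p.2) := by
  unfold ee
  have : Continuous (fun p : E × E => -(inner ℝ p.1 p.2)) := by fun_prop
  exact continuous_subtype_val.comp (Real.continuous_fourierChar.comp this)

lemma ee_continuous_right (x : E) : Continuous (ee x) :=
  ee_continuous.comp (by fun_prop : Continuous fun ξ : E => (x, ξ))

lemma ee_continuous_left (ξ : E) : Continuous (fun x => ee x ξ) :=
  ee_continuous.comp (by fun_prop : Continuous fun x : E => (x, ξ))

/-- Fourier transform of `q λ`. -/
def FT (l : Measure E) (q : E → ℂ) (x : E) : ℂ := ∫ ξ, ee x ξ * q ξ ∂l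

lemma ee_mul_integrable {l : Measure E} {q : E → ℂ} (hq : Integrable q l) (x : E) :
    Integrable (fun ξ => ee x ξ * q ξ) l :=
  hq.bdd_mul (c := 1) (ee_continuous_right x).aestronglyMeasurable
    (Eventually.of_forall fun ξ => (ee_norm x ξ).le)

lemma BAP.ee_mul (ξ : E) (a : ℂ) : BAP (fun x => ee x ξ * a) := by
  intro ε hε
  obtain ⟨n, c, hc⟩ := exists_colouring (isCompact_closedBall (0 : ℂ) 1).totallyBounded
    (fun t => ee (-t) ξ) (fun t => by simp [ee_norm]) (ε / (‖a‖ + 1)) (by positivity)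
  refine ⟨n, c, fun t t' h x => ?_⟩
  have h1 := hc t t' h
  rw [dist_eq_norm, lt_div_iff₀ (by positivity)] at h1
  show ‖ee (x - t) ξ * a - ee (x - t') ξ * a‖ < ε
  rw [sub_eq_add_neg x, sub_eq_add_neg x, ee_add, ee_add,
    show ee x ξ * ee (-t) ξ * a - ee x ξ * ee (-t') ξ * a =
      ee x ξ * ((ee (-t) ξ - ee (-t') ξ) * a) by ring, norm_mul, ee_norm, one_mul, norm_mul]
  refine lt_of_le_of_lt ?_ h1
  gcongr
  linarith

lemma BAP.FT_countable (l : Measure E) (S : Set E) (hS : S.Countable) (hl : l Sᶜ = 0)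
    (q : E → ℂ) (hq : Integrable q l) : BAP (FT l q) := by
  rcases S.eq_empty_or_nonempty with rfl | hne
  · have : l = 0 := by simpa using hl
    subst this
    have : FT (0 : Measure E) q = fun _ => 0 := by ext; simp [FT]
    rw [this]
    exact BAP.zero
  obtain ⟨u, hu⟩ := hS.exists_eq_range hne
  classical
  let B : ℕ → Finset E := fun n => (Finset.range n).image u
  have hlim : Tendsto (fun n => ∫ ξ in (↑(B n) : Set E)ᶜ, ‖q ξ‖ ∂l) atTop
      (𝓝 (∫ ξ in ⋂ n, (↑(B n) : Set E)ᶜ, ‖q ξ‖ ∂l)) := by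
    refine tendsto_setIntegral_of_antitone (fun n => (B n).measurableSet.compl) ?_
      ⟨0, hq.norm.integrableOn⟩
    intro n m hnm
    apply Set.compl_subset_compl.2
    have : B n ⊆ B m := Finset.image_subset_image (Finset.range_mono hnm)
    exact_mod_cast this
  have hz : (∫ ξ in ⋂ n, (↑(B n) : Set E)ᶜ, ‖q ξ‖ ∂l) = 0 := by
    apply setIntegral_measure_zero
    refine measure_mono_null ?_ hl
    intro x hx hxS
    rw [hu] at hxS
    obtain ⟨k, rfl⟩ := hxS
    rw [Set.mem_iInter] at hx
    refine hx (k + 1) ?_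
    simp only [B, Finset.mem_coe, Finset.mem_image, Finset.mem_range]
    exact ⟨k, by omega, rfl⟩
  rw [hz] at hlim
  refine BAP.of_approx fun ε hε => ?_
  obtain ⟨n, hn⟩ := (hlim.eventually (gt_mem_nhds hε)).exists
  refine ⟨fun x => ∫ ξ in (↑(B n) : Set E), ee x ξ * q ξ ∂l, ?_, fun x => ?_⟩
  · have : (fun x => ∫ ξ in (↑(B n) : Set E), ee x ξ * q ξ ∂l) =
        fun x => ∑ ξ ∈ B n, ee x ξ * (l.real {ξ} * q ξ) := by
      ext x
      rw [setIntegral_finset _ (ee_mul_integrable hq x).integrableOn]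
      refine Finset.sum_congr rfl fun ξ _ => ?_
      rw [Complex.real_smul]; ring
    rw [this]
    exact BAP.sum _ fun ξ _ => BAP.ee_mul ξ _
  · have : FT l q x - ∫ ξ in (↑(B n) : Set E), ee x ξ * q ξ ∂l =
        ∫ ξ in (↑(B n) : Set E)ᶜ, ee x ξ * q ξ ∂l := by
      rw [FT, ← integral_add_compl (B n).measurableSet (ee_mul_integrable hq x)]
      ring
    rw [this]
    refine (norm_integral_le_integral_norm _).trans_lt ?_
    simpa [ee_norm] using hn

end PartC

section PartD

open scoped FourierTransform RealInnerProductSpace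

variable {E : Type*} [NormedAddCommGroup E] [InnerProductSpace ℝ E] [FiniteDimensional ℝ E]
  [MeasurableSpace E] [BorelSpace E]

lemma ee_conj (x ξ : E) : conj (ee x ξ) = ee x (-ξ) := by
  simp only [ee, inner_neg_right, neg_neg]
  rw [← Circle.coe_inv_eq_conj, ← AddChar.map_neg_eq_inv, neg_neg]

lemma ee_add_right (x ξ η : E) : ee x (ξ + η) = ee x ξ * ee x η := by
  rw [ee_comm, ee_add, ee_comm x ξ, ee_comm x η]

lemma ee_smul (c : ℝ) (x ξ : E) : ee (c • x) ξ = ee x (c • ξ) := by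
  simp [ee, inner_smul_left, inner_smul_right]

/-- The standard Gaussian. -/
def gau (x : E) : ℂ := Complex.exp (-(Real.pi : ℂ) * (‖x‖ : ℂ) ^ 2)

lemma gau_integrable : Integrable (gau : E → ℂ) volume := by
  have := GaussianFourier.integrable_cexp_neg_mul_sq_norm_add (V := E) (b := (Real.pi : ℂ))
    (by simpa using Real.pi_pos) 0 0
  unfold gau
  simpa using this

lemma gau_norm (x : E) : ‖gau x‖ = Real.exp (-Real.pi * ‖x‖ ^ 2) := by
  rw [gau, Complex.norm_exp]
  norm_cast

lemma gau_norm' (x : E) : ((‖gau x‖ : ℝ) : ℂ) = gau x := by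
  rw [gau_norm, gau]
  push_cast
  rfl

lemma gau_continuous : Continuous (gau : E → ℂ) := by
  unfold gau
  fun_prop

lemma fourier_eq_ee (f : E → ℂ) (w : E) : 𝓕 f w = ∫ v, ee v w * f v := by
  rw [Real.fourier_eq]
  rfl

lemma fourier_gau (w : E) : ∫ v, ee v w * gau v = gau w := by
  rw [← fourier_eq_ee]
  have := fourier_gaussian_innerProductSpace (V := E) (b := (Real.pi : ℂ))
    (by simpa using Real.pi_pos) w
  unfold gau
  rw [this]
  have hpi : (Real.pi : ℂ) ≠ 0 := by exact_mod_cast Real.pi_ne_zero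
  rw [div_self hpi, one_cpow, one_mul]
  congr 1
  field_simp

lemma gau_integral_norm : ∫ v : E, ‖gau v‖ = 1 := by
  have h := fourier_gau (0 : E)
  have h2 : ((∫ v : E, ‖gau v‖ : ℝ) : ℂ) = 1 := by
    rw [← integral_complex_ofReal]
    simp only [gau_norm']
    simp only [ee_comm _ (0 : E), ee_zero, one_mul] at h
    rw [h, gau]
    simp
  exact_mod_cast h2

lemma FT_continuous (l : Measure E) (q : E → ℂ) (hq : Integrable q l) : Continuous (FT l q) := by
  refine continuous_of_dominated (bound := fun ξ => ‖q ξ‖)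
    (fun x => (ee_mul_integrable hq x).aestronglyMeasurable)
    (fun x => Eventually.of_forall fun ξ => by simp [ee_norm]) hq.norm
    (Eventually.of_forall fun ξ => (ee_continuous_left ξ).mul continuous_const)

lemma FT_norm_le (l : Measure E) (q : E → ℂ) (x : E) : ‖FT l q x‖ ≤ ∫ ξ, ‖q ξ‖ ∂l := by
  refine (norm_integral_le_integral_norm _).trans (le_of_eq ?_)
  simp [ee_norm]

lemma wiener_bound (l : Measure E) [SFinite l] (q : E → ℂ) (hq : Integrable q l) (n : ℝ) (y : E) :
    ∫ τ, ‖gau τ‖ * ‖FT l q (n • τ + y)‖ ^ 2 ≤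
      ∫ p : E × E, ‖gau (n • (p.1 - p.2))‖ * (‖q p.1‖ * ‖q p.2‖) ∂(l.prod l) := by
  let Φ : E → E × E → ℂ := fun τ p => (ee (n • τ + y) p.1 * ee (n • τ + y) (-p.2)) *
    (gau τ * (q p.1 * conj (q p.2)))
  have hqc : Integrable (fun ξ => conj (q ξ)) l := by
    exact (integrable_norm_iff (continuous_conj.comp_aestronglyMeasurable
      hq.aestronglyMeasurable)).1 (by simpa using hq.norm)
  have hcont : Continuous (fun z : E × (E × E) =>
      (ee (n • z.1 + y) z.2.1 * ee (n • z.1 + y) (-z.2.2))) := by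
    refine Continuous.mul ?_ ?_
    · exact ee_continuous.comp (by fun_prop : Continuous fun z : E × (E × E) => (n • z.1 + y, z.2.1))
    · exact ee_continuous.comp
        (by fun_prop : Continuous fun z : E × (E × E) => (n • z.1 + y, -z.2.2))
  have hΦ : Integrable (Function.uncurry Φ) (volume.prod (l.prod l)) := by
    refine Integrable.bdd_mul (c := 1) (gau_integrable.mul_prod (hq.mul_prod hqc))
      hcont.aestronglyMeasurable (Eventually.of_forall fun z => ?_)
    simp [ee_norm]
  have h1 : ∀ τ, ∫ p, Φ τ p ∂(l.prod l) = ((‖gau τ‖ * ‖FT l q (n • τ + y)‖ ^ 2 : ℝ) : ℂ) := by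
    intro τ
    have : ∀ p, Φ τ p = gau τ * ((ee (n • τ + y) p.1 * q p.1) *
        conj (ee (n • τ + y) p.2 * q p.2)) := by
      intro p
      simp only [Φ, map_mul, ee_conj]
      ring
    simp_rw [this]
    rw [integral_const_mul, integral_prod_mul (fun ξ => ee (n • τ + y) ξ * q ξ)
      (fun ξ => conj (ee (n • τ + y) ξ * q ξ)), integral_conj]
    push_cast
    rw [gau_norm', ← Complex.mul_conj']
    rfl
  have h2 : ∀ p, ∫ τ, Φ τ p = (ee y (p.1 - p.2) * (q p.1 * conj (q p.2))) *
      gau (n • (p.1 - p.2)) := by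
    intro p
    rw [← fourier_gau, ← integral_const_mul]
    congr 1
    ext τ
    simp only [Φ]
    rw [← ee_add_right, ← sub_eq_add_neg, ee_add, ee_smul]
    ring
  have h3 := integral_integral_swap hΦ
  simp_rw [h1, h2] at h3
  rw [integral_complex_ofReal] at h3
  have h4 : ∫ τ, ‖gau τ‖ * ‖FT l q (n • τ + y)‖ ^ 2 =
      ‖((∫ τ, ‖gau τ‖ * ‖FT l q (n • τ + y)‖ ^ 2 : ℝ) : ℂ)‖ := by
    rw [Complex.norm_real, Real.norm_of_nonneg]
    exact integral_nonneg fun τ => by positivity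
  rw [h4]
  refine (le_of_eq (congrArg norm h3)).trans ((norm_integral_le_integral_norm _).trans (le_of_eq ?_))
  congr 1
  ext p
  rw [norm_mul, norm_mul, ee_norm, norm_mul, RCLike.norm_conj]
  ring

lemma wiener_tendsto (l : Measure E) [SFinite l] (hna : ∀ x, l {x} = 0)
    (q : E → ℂ) (hq : Integrable q l) :
    Tendsto (fun n : ℕ => ∫ p : E × E, ‖gau ((n : ℝ) • (p.1 - p.2))‖ * (‖q p.1‖ * ‖q p.2‖)
      ∂(l.prod l)) atTop (𝓝 0) := by
  have hqq := hq.norm.mul_prod hq.norm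
  have : (0 : ℝ) = ∫ p : E × E, 0 ∂(l.prod l) := by simp
  rw [this]
  refine tendsto_integral_of_dominated_convergence (fun p => ‖q p.1‖ * ‖q p.2‖) (fun n => ?_) hqq
    (fun n => Eventually.of_forall fun p => ?_) ?_
  · refine AEStronglyMeasurable.mul ?_ hqq.aestronglyMeasurable
    refine Continuous.aestronglyMeasurable ?_
    exact continuous_norm.comp (gau_continuous.comp (by fun_prop))
  · rw [norm_mul, norm_norm, Real.norm_of_nonneg (by positivity : 0 ≤ ‖q p.1‖ * ‖q p.2‖)]
    refine mul_le_of_le_one_left (by positivity) ?_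
    rw [gau_norm, Real.exp_le_one_iff]
    have := Real.pi_pos
    nlinarith [sq_nonneg ‖(n : ℝ) • (p.1 - p.2)‖]
  · have hd : ∀ᵐ p ∂(l.prod l), p ∉ Set.diagonal E := by
      refine measure_eq_zero_iff_ae_notMem.1 ?_
      rw [Measure.measure_prod_null measurableSet_diagonal]
      refine Eventually.of_forall fun x => ?_
      have : Prod.mk x ⁻¹' Set.diagonal E = {x} := by
        ext y; simp [eq_comm]
      simp [this, hna]
    filter_upwards [hd] with p hp
    have hne : p.1 - p.2 ≠ 0 := sub_ne_zero.2 hp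
    rw [show (0 : ℝ) = 0 * (‖q p.1‖ * ‖q p.2‖) by ring]
    refine Tendsto.mul_const _ ?_
    simp only [gau_norm]
    refine Real.tendsto_exp_atBot.comp ?_
    have h1 : Tendsto (fun n : ℕ => ‖(n : ℝ) • (p.1 - p.2)‖) atTop atTop := by
      simp only [norm_smul, Real.norm_natCast]
      exact tendsto_natCast_atTop_atTop.atTop_mul_const (norm_pos_iff.2 hne)
    have h2 := (tendsto_pow_atTop (α := ℝ) two_ne_zero).comp h1
    exact h2.const_mul_atTop_of_neg (neg_neg_of_pos Real.pi_pos)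

lemma wiener (l : Measure E) [SFinite l] (hna : ∀ x, l {x} = 0)
    (q : E → ℂ) (hq : Integrable q l)
    (hB : BAP (FT l q)) (x0 : E) : FT l q x0 = 0 := by
  by_contra hne
  have hc0 : 0 < ‖FT l q x0‖ := norm_pos_iff.2 hne
  set c0 := ‖FT l q x0‖
  obtain ⟨N, c, hc⟩ := hB (c0 / 2) (half_pos hc0)
  classical
  have hrep : ∃ s : Fin N → E, ∀ t, c (s (c t)) = c t := by
    refine ⟨fun i => if h : ∃ t, c t = i then h.choose else 0, fun t => ?_⟩
    have h : ∃ t', c t' = c t := ⟨t, rfl⟩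
    simp only [dif_pos h]
    exact h.choose_spec
  obtain ⟨s, hs⟩ := hrep
  have hlow : ∀ t, (c0 / 2) ^ 2 ≤ ∑ i, ‖FT l q (t + (x0 - s i))‖ ^ 2 := by
    intro t
    have h1 := hc t (s (c t)) (hs t).symm (x0 + t)
    rw [add_sub_cancel_right, show x0 + t - s (c t) = t + (x0 - s (c t)) by abel] at h1
    have h2 : c0 / 2 ≤ ‖FT l q (t + (x0 - s (c t)))‖ := by
      have := norm_sub_norm_le (FT l q x0) (FT l q (t + (x0 - s (c t))))
      linarith
    calc (c0 / 2) ^ 2 ≤ ‖FT l q (t + (x0 - s (c t)))‖ ^ 2 := by gcongr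
      _ ≤ _ := Finset.single_le_sum (f := fun i => ‖FT l q (t + (x0 - s i))‖ ^ 2)
          (fun i _ => by positivity) (Finset.mem_univ _)
  have hint : ∀ (n : ℝ) (y : E), Integrable (fun τ => ‖gau τ‖ * ‖FT l q (n • τ + y)‖ ^ 2) := by
    intro n y
    refine gau_integrable.norm.mul_bdd (c := (∫ ξ, ‖q ξ‖ ∂l) ^ 2) ?_ ?_
    · refine Continuous.aestronglyMeasurable ?_
      exact ((FT_continuous l q hq).comp (by fun_prop)).norm.pow 2
    · refine Eventually.of_forall fun τ => ?_
      rw [norm_pow, norm_norm]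
      gcongr
      exact FT_norm_le _ _ _
  have hub : ∀ n : ℕ, (c0 / 2) ^ 2 ≤ N * ∫ p : E × E, ‖gau ((n : ℝ) • (p.1 - p.2))‖ *
      (‖q p.1‖ * ‖q p.2‖) ∂(l.prod l) := by
    intro n
    calc (c0 / 2) ^ 2 = ∫ τ : E, ‖gau τ‖ * (c0 / 2) ^ 2 := by
          rw [integral_mul_const, gau_integral_norm, one_mul]
      _ ≤ ∫ τ : E, ∑ i, ‖gau τ‖ * ‖FT l q ((n : ℝ) • τ + (x0 - s i))‖ ^ 2 := by
          refine integral_mono (gau_integrable.norm.mul_const _)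
            (integrable_finsetSum _ fun i _ => hint n _) fun τ => ?_
          dsimp only
          rw [← Finset.mul_sum]
          gcongr
          exact hlow _
      _ = ∑ i, ∫ τ : E, ‖gau τ‖ * ‖FT l q ((n : ℝ) • τ + (x0 - s i))‖ ^ 2 :=
          integral_finsetSum _ fun i _ => hint n _
      _ ≤ ∑ i : Fin N, _ := Finset.sum_le_sum fun i _ => wiener_bound l q hq n _
      _ = _ := by simp
  have hlim := (wiener_tendsto l hna q hq).const_mul (N : ℝ)
  rw [mul_zero] at hlim
  have := ge_of_tendsto' hlim hub
  have : 0 < (c0 / 2) ^ 2 := by positivity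
  linarith

lemma FT_pairing (l : Measure E) [SFinite l] (q : E → ℂ) (hq : Integrable q l)
    (κ : E → ℂ) (hκ : Integrable κ) :
    ∫ y, κ y * FT l q y = ∫ ξ, 𝓕 κ ξ * q ξ ∂l := by
  have hint : Integrable (Function.uncurry fun (y ξ : E) => ee y ξ * (κ y * q ξ))
      (volume.prod l) :=
    Integrable.bdd_mul (c := 1) (hκ.mul_prod hq) ee_continuous.aestronglyMeasurable
      (Eventually.of_forall fun z => by simp [ee_norm])
  have h := integral_integral_swap hint
  convert h using 1
  · congr 1
    ext y
    rw [FT, ← integral_const_mul]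
    congr 1
    ext ξ
    ring
  · congr 1
    ext ξ
    rw [fourier_eq_ee, ← integral_mul_const]
    congr 1
    ext y
    ring

lemma FT_unique (l : Measure E) [SFinite l] (q : E → ℂ) (hq : Integrable q l)
    (h0 : ∀ x, FT l q x = 0) : ∀ᵐ ξ ∂l, q ξ = 0 := by
  refine ae_eq_zero_of_integral_contDiff_smul_eq_zero hq.locallyIntegrable fun g hg hgs => ?_
  have hs : HasCompactSupport (fun x => ((g x : ℝ) : ℂ)) := hgs.comp_left Complex.ofReal_zero
  have hd : ContDiff ℝ (↑(⊤ : ℕ∞)) (fun x => ((g x : ℝ) : ℂ)) := Complex.ofRealCLM.contDiff.comp hg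
  let φ : SchwartzMap E ℂ := hs.toSchwartzMap hd
  have h := FT_pairing l q hq (𝓕⁻ φ : SchwartzMap E ℂ) (SchwartzMap.integrable _)
  rw [← SchwartzMap.fourier_coe, FourierTransform.fourier_fourierInv_eq] at h
  simp only [h0, mul_zero, integral_zero] at h
  rw [h]
  congr 1

end PartD

section PartE

open scoped FourierTransform RealInnerProductSpace

variable {E : Type*} [NormedAddCommGroup E] [InnerProductSpace ℝ E] [FiniteDimensional ℝ E]
  [MeasurableSpace E] [BorelSpace E]

lemma fourierInv_eq_ee (f : E → ℂ) (w : E) : 𝓕⁻ f w = ∫ v, ee (-v) w * f v := by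
  rw [Real.fourierInv_eq]
  congr 1
  ext v
  simp only [ee, inner_neg_left, neg_neg]
  rfl

lemma fourier_transRefl (x : E) (ψ : SchwartzMap E ℂ) (ξ : E) :
    (𝓕 (transRefl x ψ) : SchwartzMap E ℂ) ξ = ee x ξ * (𝓕⁻ ψ : SchwartzMap E ℂ) ξ := by
  rw [SchwartzMap.fourier_coe, SchwartzMap.fourierInv_coe, fourier_eq_ee, fourierInv_eq_ee,
    ← integral_const_mul, ← integral_sub_left_eq_self _ volume x]
  congr 1
  ext v
  rw [transRefl_apply, sub_sub_cancel, sub_eq_add_neg, ee_add]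
  ring

/-- The product of a test function with a Schwartz function. -/
def prodTest (χ : SchwartzMap E ℂ) (hχ : IsTestFn χ) (g : SchwartzMap E ℂ) : SchwartzMap E ℂ :=
  HasCompactSupport.toSchwartzMap (f := fun ξ => χ ξ * g ξ)
    (HasCompactSupport.mul_right hχ) ((χ.smooth _).mul (g.smooth _))

lemma prodTest_apply (χ : SchwartzMap E ℂ) (hχ : IsTestFn χ) (g : SchwartzMap E ℂ) (ξ : E) :
    prodTest χ hχ g ξ = χ ξ * g ξ := rfl

lemma q_integrable (μ : CMeasure E) (χ : SchwartzMap E ℂ) (hχ : IsTestFn χ)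
    (g : SchwartzMap E ℂ) : Integrable (fun ξ => χ ξ * g ξ * μ.density ξ) μ.tv := by
  have := μ.locFin
  have h1 : Integrable (fun ξ => χ ξ * g ξ) μ.tv :=
    (χ.continuous.mul g.continuous).integrable_of_hasCompactSupport
      (HasCompactSupport.mul_right hχ)
  refine h1.mul_bdd (c := 1) μ.density_meas.aestronglyMeasurable ?_
  filter_upwards [μ.density_norm] with ξ h using h.le

lemma main_identity (μ : CMeasure E) (T : SchwartzMap E ℂ →L[ℂ] ℂ) (hμT : μ.Agrees T)
    (ψ χ : SchwartzMap E ℂ) (hχ : IsTestFn χ) (x : E) :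
    FT μ.tv (fun ξ => χ ξ * (𝓕⁻ ψ : SchwartzMap E ℂ) ξ * μ.density ξ) x =
      ∫ y, (𝓕 χ : SchwartzMap E ℂ) y * convTD (fourierTD T) ψ (x - y) := by
  set K : SchwartzMap E ℂ := 𝓕 (prodTest χ hχ (𝓕⁻ ψ)) with hK
  rw [← convTD_conv (fourierTD T) ψ (𝓕 χ) K]
  · have h1 : ∀ ξ, (𝓕 (transRefl x K) : SchwartzMap E ℂ) ξ =
        ee x ξ * (χ ξ * (𝓕⁻ ψ : SchwartzMap E ℂ) ξ) := by
      intro ξ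
      rw [fourier_transRefl, hK, FourierTransform.fourierInv_fourier_eq, prodTest_apply]
    have h2 : IsTestFn (𝓕 (transRefl x K) : SchwartzMap E ℂ) := by
      have : ⇑(𝓕 (transRefl x K) : SchwartzMap E ℂ) =
        fun ξ => ee x ξ * (χ ξ * (𝓕⁻ ψ : SchwartzMap E ℂ) ξ) := funext h1
      rw [IsTestFn, this]
      exact HasCompactSupport.mul_left (HasCompactSupport.mul_right hχ)
    have h3 : convTD (fourierTD T) K x = T (𝓕 (transRefl x K)) := rfl
    rw [h3, hμT _ h2, CMeasure.pairing, FT]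
    congr 1
    ext ξ
    rw [h1]
    ring
  · intro z
    have h := FT_pairing volume (transRefl z ψ) (SchwartzMap.integrable _) χ
      (SchwartzMap.integrable _)
    simp only [SchwartzMap.fourier_coe]
    simp only [transRefl_apply] at h
    rw [← h, hK, SchwartzMap.fourier_coe, fourier_eq_ee]
    congr 1
    ext ξ
    have h4 : FT volume (transRefl z ψ) ξ = (𝓕 (transRefl z ψ) : SchwartzMap E ℂ) ξ := by
      rw [SchwartzMap.fourier_coe, fourier_eq_ee, FT]
      simp only [ee_comm]
    rw [prodTest_apply, h4, fourier_transRefl, ee_comm]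
    ring

lemma exists_good_chi (ε : ℝ) (hε : 0 < ε) : ∃ χ : SchwartzMap E ℂ, IsTestFn χ ∧
    ∫ y, (𝓕 χ : SchwartzMap E ℂ) y = 1 ∧ ∫ y, ‖(𝓕 χ : SchwartzMap E ℂ) y‖ * ‖y‖ < ε := by
  let b : ContDiffBump (0 : E) := ⟨1, 2, by norm_num, by norm_num⟩
  have hbs : HasCompactSupport (fun x => ((b x : ℝ) : ℂ)) :=
    b.hasCompactSupport.comp_left Complex.ofReal_zero
  have hbd : ContDiff ℝ (↑(⊤ : ℕ∞)) (fun x => ((b x : ℝ) : ℂ)) :=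
    Complex.ofRealCLM.contDiff.comp b.contDiff
  let χ0 : SchwartzMap E ℂ := hbs.toSchwartzMap hbd
  have hχ0 : ∀ x, χ0 x = (b x : ℂ) := fun x => rfl
  set M := ∫ y, ‖(𝓕 χ0 : SchwartzMap E ℂ) y‖ * ‖y‖ with hM
  have hM0 : 0 ≤ M := integral_nonneg fun y => by positivity
  let r : ℝ := ε / (M + 1)
  have hr : 0 < r := by positivity
  have hrs : HasCompactSupport (fun x : E => χ0 (r • x)) :=
    HasCompactSupport.comp_smul (f := χ0) hbs hr.ne'
  have hrd : ContDiff ℝ (↑(⊤ : ℕ∞)) (fun x : E => χ0 (r • x)) :=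
    (χ0.smooth _).comp (contDiff_const_smul r)
  let χ : SchwartzMap E ℂ := hrs.toSchwartzMap hrd
  have hχ : ∀ x, χ x = χ0 (r • x) := fun x => rfl
  refine ⟨χ, hrs, ?_, ?_⟩
  · have h1 : (𝓕⁻ (𝓕 χ : SchwartzMap E ℂ) : SchwartzMap E ℂ) 0 = χ 0 := by
      rw [FourierTransform.fourierInv_fourier_eq]
    rw [SchwartzMap.fourierInv_coe, fourierInv_eq_ee] at h1
    simp only [ee_comm _ (0 : E), ee_zero, one_mul] at h1
    rw [h1, hχ, smul_zero, hχ0, b.one_of_mem_closedBall (by simp [b])]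
    simp
  · have hF : ∀ y, (𝓕 χ : SchwartzMap E ℂ) y =
        (|(r ^ Module.finrank ℝ E)⁻¹| : ℝ) • (𝓕 χ0 : SchwartzMap E ℂ) (r⁻¹ • y) := by
      intro y
      rw [SchwartzMap.fourier_coe, SchwartzMap.fourier_coe, fourier_eq_ee, fourier_eq_ee,
        ← Measure.integral_comp_smul]
      congr 1
      ext v
      rw [hχ, ee_smul, smul_smul, mul_inv_cancel₀ hr.ne', one_smul]
    have hI : ∫ y, ‖(𝓕 χ : SchwartzMap E ℂ) y‖ * ‖y‖ = r * M := by
      have h1 : ∀ y, ‖(𝓕 χ : SchwartzMap E ℂ) y‖ * ‖y‖ =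
          (|(r ^ Module.finrank ℝ E)⁻¹| * r) *
          (fun z => ‖(𝓕 χ0 : SchwartzMap E ℂ) z‖ * ‖z‖) (r⁻¹ • y) := by
        intro y
        dsimp only
        rw [hF, norm_smul, norm_smul, Real.norm_eq_abs, abs_abs, norm_inv, Real.norm_of_nonneg hr.le]
        field_simp
      simp_rw [h1]
      rw [integral_const_mul, Measure.integral_comp_smul volume
        (fun z => ‖(𝓕 χ0 : SchwartzMap E ℂ) z‖ * ‖z‖) r⁻¹, ← hM, smul_eq_mul]
      have : (0 : ℝ) < r ^ Module.finrank ℝ E := by positivity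
      rw [abs_of_pos (by positivity), abs_of_pos (by positivity), inv_pow]
      field_simp
    rw [hI]
    have : r * M < r * (M + 1) := by nlinarith
    refine this.trans_le (le_of_eq ?_)
    simp only [r]
    field_simp

lemma conv_BAP (f : E → ℂ) (hf : Continuous f) (hb : ∃ C : ℝ, ∀ x, ‖f x‖ ≤ C) (hB : BAP f)
    (κ : E → ℂ) (hκ : Integrable κ) : BAP (fun x => ∫ y, κ y * f (x - y)) := by
  obtain ⟨C, hC⟩ := hb
  have hint : ∀ x, Integrable (fun y => κ y * f (x - y)) := fun x =>
    hκ.mul_bdd (c := C) (hf.comp (by fun_prop)).aestronglyMeasurable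
      (Eventually.of_forall fun y => hC _)
  intro ε hε
  have hN : 0 ≤ ∫ y, ‖κ y‖ := integral_nonneg fun y => norm_nonneg _
  obtain ⟨n, c, hc⟩ := hB (ε / ((∫ y, ‖κ y‖) + 1)) (by positivity)
  refine ⟨n, c, fun t t' h x => ?_⟩
  dsimp only
  rw [← integral_sub (hint _) (hint _)]
  calc ‖∫ y, (κ y * f (x - t - y) - κ y * f (x - t' - y))‖
      ≤ ∫ y, ‖κ y‖ * (ε / ((∫ y, ‖κ y‖) + 1)) := by
        refine norm_integral_le_of_norm_le (hκ.norm.mul_const _) (Eventually.of_forall fun y => ?_)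
        rw [← mul_sub, norm_mul]
        gcongr
        rw [sub_right_comm, sub_right_comm x t']
        exact (hc t t' h (x - y)).le
    _ = (∫ y, ‖κ y‖) * (ε / ((∫ y, ‖κ y‖) + 1)) := integral_mul_const _ _
    _ < ε := by
        rw [mul_div_assoc', div_lt_iff₀ (by positivity)]
        nlinarith

lemma exists_test_ne (ξ0 : E) : ∃ ψ : SchwartzMap E ℂ, IsTestFn ψ ∧
    (𝓕⁻ ψ : SchwartzMap E ℂ) ξ0 ≠ 0 := by
  by_contra! hcon
  have hc : Continuous (fun v => ee (-v) ξ0) := (ee_continuous_left ξ0).comp continuous_neg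
  have h : ∀ᵐ v : E, ee (-v) ξ0 = 0 := by
    refine ae_eq_zero_of_integral_contDiff_smul_eq_zero hc.locallyIntegrable fun g hg hgs => ?_
    have hs : HasCompactSupport (fun x => ((g x : ℝ) : ℂ)) := hgs.comp_left Complex.ofReal_zero
    have hd : ContDiff ℝ (↑(⊤ : ℕ∞)) (fun x => ((g x : ℝ) : ℂ)) :=
      Complex.ofRealCLM.contDiff.comp hg
    have := hcon (hs.toSchwartzMap hd) hs
    rw [SchwartzMap.fourierInv_coe, fourierInv_eq_ee] at this
    rw [← this]
    congr 1
    ext v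
    rw [Complex.real_smul, mul_comm]
    rfl
  obtain ⟨v, hv⟩ := h.exists
  have := ee_norm (-v) ξ0
  rw [hv] at this
  simp at this

theorem main_iff (μ : CMeasure E) (T : SchwartzMap E ℂ →L[ℂ] ℂ) (hμT : μ.Agrees T) :
    SAPD (fourierTD T) ↔ (TransBddD (fourierTD T) ∧ μ.IsPurePoint) := by
  have := μ.locFin
  constructor
  · intro h
    refine ⟨fun ψ hψ => (h ψ hψ).2.1, ?_⟩
    set A : Set E := {ξ | 0 < μ.tv {ξ}} with hA
    have hAc : A.Countable := by
      refine Measure.countable_meas_pos_of_disjoint_iUnion (fun ξ => measurableSet_singleton ξ) ?_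
      intro a b hab
      simpa [Function.onFun] using hab
    refine ⟨A, hAc, measure_null_of_locally_null _ fun ξ0 _ => ?_⟩
    obtain ⟨ψ, hψ, hψ0⟩ := exists_test_ne ξ0
    let b : ContDiffBump ξ0 := ⟨1, 2, by norm_num, by norm_num⟩
    have hbs : HasCompactSupport (fun x => ((b x : ℝ) : ℂ)) :=
      b.hasCompactSupport.comp_left Complex.ofReal_zero
    have hbd : ContDiff ℝ (↑(⊤ : ℕ∞)) (fun x => ((b x : ℝ) : ℂ)) :=
      Complex.ofRealCLM.contDiff.comp b.contDiff
    let χ : SchwartzMap E ℂ := hbs.toSchwartzMap hbd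
    have hχ : ∀ x, χ x = (b x : ℂ) := fun x => rfl
    have hχt : IsTestFn χ := hbs
    set g : SchwartzMap E ℂ := 𝓕⁻ ψ
    set q : E → ℂ := fun ξ => χ ξ * g ξ * μ.density ξ with hq
    have hqi : Integrable q μ.tv := q_integrable μ χ hχt g
    have hap := h ψ hψ
    have hB : BAP (FT μ.tv q) := by
      have : FT μ.tv q = fun x => ∫ y, (𝓕 χ : SchwartzMap E ℂ) y * convTD (fourierTD T) ψ (x - y) :=
        funext fun x => main_identity μ T hμT ψ χ hχt x
      rw [this]
      exact conv_BAP _ hap.1.continuous hap.2.1 (BAP.of_isBohrAP hap) _ (SchwartzMap.integrable _)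
    have hAm : MeasurableSet A := hAc.measurableSet
    have hBp : BAP (FT (μ.tv.restrict A) q) :=
      BAP.FT_countable _ A hAc (by rw [Measure.restrict_apply hAm.compl]; simp) q hqi.restrict
    have hBc : BAP (FT (μ.tv.restrict Aᶜ) q) := by
      have : FT (μ.tv.restrict Aᶜ) q = fun x => FT μ.tv q x + - FT (μ.tv.restrict A) q x := by
        ext x
        simp only [FT]
        rw [← integral_add_compl hAm (ee_mul_integrable hqi x)]
        ring
      rw [this]
      exact hB.add hBp.neg
    have hna : ∀ x, μ.tv.restrict Aᶜ {x} = 0 := by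
      intro x
      rw [Measure.restrict_apply (measurableSet_singleton x)]
      by_cases hx : x ∈ A
      · rw [show ({x} : Set E) ∩ Aᶜ = ∅ by ext y; simp +contextual [hx]]
        simp
      · refine measure_mono_null Set.inter_subset_left ?_
        simpa [hA] using hx
    have hz := FT_unique _ q hqi.restrict (wiener _ hna q hqi.restrict hBc)
    rw [ae_restrict_iff' hAm.compl] at hz
    refine ⟨Aᶜ ∩ ({ξ | g ξ ≠ 0} ∩ ball ξ0 2), ?_, ?_⟩
    · refine inter_mem_nhdsWithin _ (inter_mem ?_ (ball_mem_nhds _ (by norm_num)))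
      exact (isOpen_ne_fun g.continuous continuous_const).mem_nhds hψ0
    · rw [measure_eq_zero_iff_ae_notMem]
      filter_upwards [hz, μ.density_norm] with ξ h1 h2 h3
      have h4 := h1 h3.1
      simp only [hq, mul_eq_zero] at h4
      rcases h4 with (h4 | h4) | h4
      · rw [hχ, Complex.ofReal_eq_zero] at h4
        exact (b.pos_of_mem_ball h3.2.2).ne' h4
      · exact h3.2.1 h4
      · rw [h4] at h2; simp at h2
  · rintro ⟨hT, S, hS, hS0⟩ ψ hψ
    obtain ⟨C, hC0, hC⟩ := convTD_lipschitz (fourierTD T) hT ψ hψ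
    set f := convTD (fourierTD T) ψ with hf
    have hlip : LipschitzWith ⟨C, hC0⟩ f := by
      refine LipschitzWith.of_dist_le_mul fun x y => ?_
      have := hC y (x - y)
      rw [add_sub_cancel] at this
      rw [dist_eq_norm, dist_eq_norm]
      exact this
    obtain ⟨D, hD⟩ := hT ψ hψ
    refine BAP.isBohrAP ?_ hlip.uniformContinuous ⟨D, hD⟩
    refine BAP.of_approx fun ε hε => ?_
    obtain ⟨χ, hχ, hχ1, hχ2⟩ := exists_good_chi (E := E) (ε / (C + 1)) (by positivity)
    refine ⟨_, BAP.FT_countable μ.tv S hS hS0 _ (q_integrable μ χ hχ (𝓕⁻ ψ)), fun x => ?_⟩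
    rw [main_identity μ T hμT ψ χ hχ x, ← hf]
    have hκ : Integrable (𝓕 χ : SchwartzMap E ℂ) := SchwartzMap.integrable _
    have hi : Integrable (fun y => (𝓕 χ : SchwartzMap E ℂ) y * f (x - y)) :=
      hκ.mul_bdd (c := D) (hlip.continuous.comp (by fun_prop)).aestronglyMeasurable
        (Eventually.of_forall fun y => hD _)
    have hfx : f x = ∫ y, (𝓕 χ : SchwartzMap E ℂ) y * f x := by
      rw [integral_mul_const, hχ1, one_mul]
    rw [hfx, ← integral_sub (hκ.mul_const _) hi]
    have hw : Integrable (fun y => ‖(𝓕 χ : SchwartzMap E ℂ) y‖ * ‖y‖) := by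
      have := SchwartzMap.integrable_pow_mul volume (𝓕 χ : SchwartzMap E ℂ) 1
      simpa [mul_comm] using this
    calc ‖∫ y, ((𝓕 χ : SchwartzMap E ℂ) y * f x - (𝓕 χ : SchwartzMap E ℂ) y * f (x - y))‖
        ≤ ∫ y, C * (‖(𝓕 χ : SchwartzMap E ℂ) y‖ * ‖y‖) := by
          refine norm_integral_le_of_norm_le (hw.const_mul _) (Eventually.of_forall fun y => ?_)
          rw [← mul_sub, norm_mul]
          have := hC (x - y) y
          rw [sub_add_cancel] at this
          calc _ ≤ ‖(𝓕 χ : SchwartzMap E ℂ) y‖ * (C * ‖y‖) := by gcongr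
            _ = _ := by ring
      _ = C * ∫ y, ‖(𝓕 χ : SchwartzMap E ℂ) y‖ * ‖y‖ := integral_const_mul _ _
      _ ≤ C * (ε / (C + 1)) := by gcongr
      _ < ε := by
          rw [mul_div_assoc', div_lt_iff₀ (by positivity)]
          nlinarith

end PartE

/-- For a tempered measure `T` on `ℝ^d`, the Fourier transform `T̂` is
strongly almost periodic as a distribution iff `T̂` is translation bounded as a
distribution and `T` is pure point. -/
theorem fourier_sapD_iff (d : ℕ)
    (μ : CMeasure (EuclideanSpace ℝ (Fin d)))
    (T : SchwartzMap (EuclideanSpace ℝ (Fin d)) ℂ →L[ℂ] ℂ)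
    (hμT : μ.Agrees T) :
    SAPD (fourierTD T) ↔ (TransBddD (fourierTD T) ∧ μ.IsPurePoint) := by
  exact main_iff μ T hμT
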